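/- arXiv:2510.26522 — 2 statements merged into one kernel-verified Lean document; each statement's English description precedes it below -/
import Mathlib

section
/- Let P be a quasicontinuous domain that is not quasialgebraic. Then there exist a Scott open set U ⊆ P, a point x ∈ U, and a nonempty finite subset F ⊆ P such that x ∈ int_{σ(P)}(↑F) ⊆ ↑F ⊆ U, neither ↑x nor ↑F is Scott open, and there is no nonempty finite subset G ⊆ P with ↑G Scott open and x ∈ ↑G ⊆ U. -/
open Set

/-- The upper set `↑A` generated by a subset `A` of a preordered set. -/
def upSet {P : Type*} [Preorder P] (A : Set P) : Set P := {y | ∃ a ∈ A, a ≤ y}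

/-- The lower set `↓A` generated by a subset `A` of a preordered set. -/
def downSet {P : Type*} [Preorder P] (A : Set P) : Set P := {y | ∃ a ∈ A, y ≤ a}

/-- A poset is a dcpo if every (nonempty) directed subset has a least upper bound. -/
def IsDcpo (P : Type*) [Preorder P] : Prop :=
  ∀ D : Set P, D.Nonempty → DirectedOn (· ≤ ·) D → ∃ s, IsLUB D s

/-- A subset `U` is Scott open if it is an upper set and every directed set whose
supremum lies in `U` meets `U`. -/
def ScottOpen {P : Type*} [Preorder P] (U : Set P) : Prop :=
  IsUpperSet U ∧ ∀ D : Set P, ∀ s : P, D.Nonempty → DirectedOn (· ≤ ·) D →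
    IsLUB D s → s ∈ U → (D ∩ U).Nonempty

/-- The Scott topology `σ(P)`. -/
def scottT (P : Type*) [Preorder P] : TopologicalSpace P where
  IsOpen := ScottOpen
  isOpen_univ := ⟨isUpperSet_univ, fun D _ hD _ _ _ => hD.imp fun _ hd => ⟨hd, trivial⟩⟩
  isOpen_inter := by
    rintro U V ⟨hU, hU'⟩ ⟨hV, hV'⟩
    refine ⟨hU.inter hV, fun D s hD hdir hlub hs => ?_⟩
    obtain ⟨d₁, hd₁D, hd₁U⟩ := hU' D s hD hdir hlub hs.1
    obtain ⟨d₂, hd₂D, hd₂V⟩ := hV' D s hD hdir hlub hs.2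
    obtain ⟨d, hdD, h₁, h₂⟩ := hdir d₁ hd₁D d₂ hd₂D
    exact ⟨d, hdD, hU h₁ hd₁U, hV h₂ hd₂V⟩
  isOpen_sUnion := by
    intro S hS
    refine ⟨isUpperSet_sUnion fun U hU => (hS U hU).1, fun D s hD hdir hlub hs => ?_⟩
    obtain ⟨U, hUS, hsU⟩ := hs
    obtain ⟨d, hdD, hdU⟩ := (hS U hUS).2 D s hD hdir hlub hsU
    exact ⟨d, hdD, U, hUS, hdU⟩

/-- Scott interior. -/
def scottInt (P : Type*) [Preorder P] (A : Set P) : Set P := @interior P (scottT P) A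

/-- Scott closure. -/
def scottCl (P : Type*) [Preorder P] (A : Set P) : Set P := @closure P (scottT P) A

/-- The lower topology `ω(P)`, generated by the complements of principal upper sets. -/
def lowerT (P : Type*) [Preorder P] : TopologicalSpace P :=
  .generateFrom {V | ∃ x : P, V = (Ici x)ᶜ}

/-- The upper topology `υ(P)`, generated by the complements of principal lower sets. -/
def upperT (P : Type*) [Preorder P] : TopologicalSpace P :=
  .generateFrom {V | ∃ x : P, V = (Iic x)ᶜ}

/-- The Lawson topology `λ(P)`, generated by `σ(P) ∪ ω(P)`. -/
def lawsonT (P : Type*) [Preorder P] : TopologicalSpace P :=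
  .generateFrom ({U | ScottOpen U} ∪ {V | ∃ x : P, V = (Ici x)ᶜ})

/-- The interval topology `θ(P)`, generated by `ω(P) ∪ υ(P)`. -/
def intervalT (P : Type*) [Preorder P] : TopologicalSpace P :=
  .generateFrom ({V | ∃ x : P, V = (Ici x)ᶜ} ∪ {V | ∃ x : P, V = (Iic x)ᶜ})

/-- `A ≪ B`: for every directed set `D` with `sup D ∈ ↑B`, `D` meets `↑A`. -/
def WayBelowSet {P : Type*} [Preorder P] (A B : Set P) : Prop :=
  ∀ D : Set P, ∀ s : P, D.Nonempty → DirectedOn (· ≤ ·) D → IsLUB D s →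
    s ∈ upSet B → (D ∩ upSet A).Nonempty

/-- `u ≪ x`: every directed set `D` with `sup D ≥ x` contains some `d ≥ u`. -/
def WayBelowPt {P : Type*} [Preorder P] (u x : P) : Prop :=
  ∀ D : Set P, ∀ s : P, D.Nonempty → DirectedOn (· ≤ ·) D → IsLUB D s →
    x ≤ s → ∃ d ∈ D, u ≤ d

/-- A family of sets is filtered if it is (nonempty and) directed under reverse inclusion. -/
def Filtered {P : Type*} (𝒜 : Set (Set P)) : Prop :=
  𝒜.Nonempty ∧ ∀ S ∈ 𝒜, ∀ T ∈ 𝒜, ∃ R ∈ 𝒜, R ⊆ S ∧ R ⊆ T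

/-- The family `{↑F : F nonempty finite, F ≪ x}`. -/
def finWayFamily {P : Type*} [Preorder P] (x : P) : Set (Set P) :=
  {S | ∃ F : Set P, F.Nonempty ∧ F.Finite ∧ WayBelowSet F {x} ∧ S = upSet F}

/-- A quasicontinuous domain. -/
def IsQuasicontinuousDomain (P : Type*) [Preorder P] : Prop :=
  ∀ x : P, Filtered (finWayFamily x) ∧ Ici x = ⋂₀ finWayFamily x

/-- The family `{↑F : F nonempty finite, x ∈ ↑F, F ≪ F}`. -/
def finCompactFamily {P : Type*} [Preorder P] (x : P) : Set (Set P) :=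
  {S | ∃ F : Set P, F.Nonempty ∧ F.Finite ∧ x ∈ upSet F ∧ WayBelowSet F F ∧ S = upSet F}

/-- A quasialgebraic domain. -/
def IsQuasialgebraicDomain (P : Type*) [Preorder P] : Prop :=
  ∀ x : P, Filtered (finCompactFamily x) ∧ Ici x = ⋂₀ finCompactFamily x

/-- A continuous domain: every `⇓x` is directed (hence nonempty) with supremum `x`. -/
def IsContinuousDomain (P : Type*) [Preorder P] : Prop :=
  ∀ x : P, {u | WayBelowPt u x}.Nonempty ∧ DirectedOn (· ≤ ·) {u | WayBelowPt u x} ∧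
    IsLUB {u | WayBelowPt u x} x

/-- The set `K(P)` of compact elements. -/
def compacts (P : Type*) [Preorder P] : Set P := {k | WayBelowPt k k}

/-- An algebraic domain. -/
def IsAlgebraicDomain (P : Type*) [Preorder P] : Prop :=
  ∀ x : P, (compacts P ∩ Iic x).Nonempty ∧ DirectedOn (· ≤ ·) (compacts P ∩ Iic x) ∧
    IsLUB (compacts P ∩ Iic x) x

/-- A meet-continuous dcpo: whenever `x ≤ sup D` for a directed set `D`,
`x` lies in the Scott closure of `↓x ∩ ↓D`. -/
def MeetContinuous (P : Type*) [Preorder P] : Prop :=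
  ∀ x : P, ∀ D : Set P, ∀ s : P, D.Nonempty → DirectedOn (· ≤ ·) D → IsLUB D s → x ≤ s →
    x ∈ scottCl P (Iic x ∩ downSet D)

/-- The set of dyadic rationals in `[0,1]`. -/
def dyadics : Set ℝ := {t | ∃ m n : ℕ, m ≤ 2 ^ n ∧ t = (m : ℝ) / 2 ^ n}

/-- A lower set version of Rudin's lemma. -/
theorem exists_directed_lowerSet_of_filtered {P : Type*} [Preorder P] {𝒢 : Set (Set P)}
    (hne : 𝒢.Nonempty) (hfin : ∀ G ∈ 𝒢, G.Finite)
    (hfil : ∀ A ∈ 𝒢, ∀ B ∈ 𝒢, ∃ C ∈ 𝒢, C ⊆ upSet A ∩ upSet B)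
    {C : Set P} (hC : IsLowerSet C) (hmeet : ∀ G ∈ 𝒢, (C ∩ G).Nonempty) :
    ∃ L ⊆ C, L.Nonempty ∧ DirectedOn (· ≤ ·) L ∧ ∀ G ∈ 𝒢, (L ∩ G).Nonempty := by
  obtain ⟨L, ⟨hlow, hLC, hL⟩, hmin⟩ := zorn_superset
    {L : Set P | IsLowerSet L ∧ L ⊆ C ∧ ∀ G ∈ 𝒢, (L ∩ G).Nonempty} (by
      intro c hc hchain
      rcases c.eq_empty_or_nonempty with rfl | hcne
      · exact ⟨C, ⟨hC, subset_rfl, hmeet⟩, by simp⟩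
      refine ⟨⋂₀ c, ⟨isLowerSet_sInter fun s hs => (hc hs).1, ?_, fun G hG => ?_⟩,
        fun s hs => sInter_subset_of_mem hs⟩
      · obtain ⟨s, hs⟩ := hcne
        exact (sInter_subset_of_mem hs).trans (hc hs).2.1
      · by_contra hemp
        have key : ∀ T : Set P, T.Finite → (∀ g ∈ T, ∃ s ∈ c, g ∉ s) →
            ∃ s ∈ c, ∀ g ∈ T, g ∉ s := by
          intro T hT
          induction T, hT using Set.Finite.induction_on with
          | empty => intro _; exact hcne.imp fun s hs => ⟨hs, by simp⟩
          | @insert a T _ _ ih =>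
            intro h
            obtain ⟨s, hs, hsT⟩ := ih fun g hg => h g (mem_insert_of_mem _ hg)
            obtain ⟨t, ht, hat⟩ := h a (mem_insert _ _)
            rcases hchain.total hs ht with hst | hts
            · refine ⟨s, hs, ?_⟩
              rintro g (rfl | hg)
              · exact fun h => hat (hst h)
              · exact hsT g hg
            · refine ⟨t, ht, ?_⟩
              rintro g (rfl | hg)
              · exact hat
              · exact fun h => hsT g hg (hts h)
        obtain ⟨s, hs, hsG⟩ := key G (hfin G hG) (by
          intro g hg
          by_contra! h
          exact hemp ⟨g, fun s hs => h s hs, hg⟩)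
        obtain ⟨g, hgs, hgG⟩ := (hc hs).2.2 G hG
        exact hsG g hgG hgs)
  have hmiss : ∀ a ∈ L, ∃ G ∈ 𝒢, ∀ g ∈ G, g ∈ L → a ≤ g := by
    intro a ha
    by_contra! h
    have hsub := hmin (y := L \ Ici a)
      ⟨fun x y hyx hx => ⟨hlow hyx hx.1, fun hy => hx.2 (le_trans hy hyx)⟩,
        sdiff_subset.trans hLC, fun G hG => by
          obtain ⟨g, hg, hgL, hag⟩ := h G hG
          exact ⟨g, ⟨hgL, hag⟩, hg⟩⟩ sdiff_subset
    exact (hsub ha).2 le_rfl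
  refine ⟨L, hLC, ?_, fun a ha b hb => ?_, hL⟩
  · obtain ⟨G, hG⟩ := hne
    exact (hL G hG).mono inter_subset_left
  · obtain ⟨A, hA, hA'⟩ := hmiss a ha
    obtain ⟨B, hB, hB'⟩ := hmiss b hb
    obtain ⟨G, hG, hGAB⟩ := hfil A hA B hB
    obtain ⟨g, hgL, hgG⟩ := hL G hG
    obtain ⟨⟨p, hp, hpg⟩, q, hq, hqg⟩ := hGAB hgG
    exact ⟨g, hgL, (hA' p hp (hlow hpg hgL)).trans hpg, (hB' q hq (hlow hqg hgL)).trans hqg⟩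

theorem IsDcpo.exists_subset_of_filtered {P : Type*} [Preorder P] (hdcpo : IsDcpo P)
    {𝒢 : Set (Set P)} (hne : 𝒢.Nonempty) (hfin : ∀ G ∈ 𝒢, G.Finite)
    (hfil : ∀ A ∈ 𝒢, ∀ B ∈ 𝒢, ∃ C ∈ 𝒢, C ⊆ upSet A ∩ upSet B)
    {V : Set P} (hV : IsUpperSet V)
    (hmeet : ∀ (D : Set P) (s : P), D.Nonempty → DirectedOn (· ≤ ·) D → IsLUB D s →
      (∀ G ∈ 𝒢, s ∈ upSet G) → (D ∩ V).Nonempty) :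
    ∃ G ∈ 𝒢, G ⊆ V := by
  by_contra! h
  obtain ⟨L, hLC, hLne, hdir, hL⟩ := exists_directed_lowerSet_of_filtered hne hfin hfil hV.compl
    fun G hG => by
      obtain ⟨g, hg, hgV⟩ := not_subset.1 (h G hG)
      exact ⟨g, hgV, hg⟩
  obtain ⟨s, hs⟩ := hdcpo L hLne hdir
  obtain ⟨d, hdL, hdV⟩ := hmeet L s hLne hdir hs fun G hG => by
    obtain ⟨g, hgL, hgG⟩ := hL G hG
    exact ⟨g, hgG, hs.1 hgL⟩
  exact hLC hdL hdV

theorem isUpperSet_upSet {P : Type*} [Preorder P] (A : Set P) : IsUpperSet (upSet A) :=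
  fun _ _ hxy ⟨a, ha, hax⟩ => ⟨a, ha, hax.trans hxy⟩

theorem subset_upSet {P : Type*} [Preorder P] (A : Set P) : A ⊆ upSet A :=
  fun a ha => ⟨a, ha, le_rfl⟩

theorem upSet_subset {P : Type*} [Preorder P] {A V : Set P} (hV : IsUpperSet V) (h : A ⊆ V) :
    upSet A ⊆ V :=
  fun _ ⟨_, ha, hay⟩ => hV hay (h ha)

theorem upSet_singleton {P : Type*} [Preorder P] (x : P) : upSet {x} = Ici x := by
  ext y
  simp [upSet]

theorem wayBelowSet_self_iff {P : Type*} [Preorder P] {G : Set P} :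
    WayBelowSet G G ↔ ScottOpen (upSet G) :=
  ⟨fun h => ⟨isUpperSet_upSet G, h⟩, fun h => h.2⟩

theorem WayBelowSet.mono_right {P : Type*} [Preorder P] {F : Set P} {x y : P}
    (h : WayBelowSet F {x}) (hxy : x ≤ y) : WayBelowSet F {y} := fun D s hD hdir hs hys =>
  h D s hD hdir hs (by rw [upSet_singleton] at hys ⊢; exact hxy.trans hys)

theorem WayBelowSet.mem_upSet {P : Type*} [Preorder P] {F : Set P} {x : P}
    (h : WayBelowSet F {x}) : x ∈ upSet F := by
  obtain ⟨_, rfl, hd⟩ := h {x} x (singleton_nonempty x)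
    (fun a ha b hb => ⟨x, rfl, le_of_eq ha, le_of_eq hb⟩) isLUB_singleton (subset_upSet _ rfl)
  exact hd

/-- A finite set way below some element of `D` exists inside every upper set that is met by all
directed sets whose supremum lies above `sup D`. -/
theorem IsQuasicontinuousDomain.exists_wayBelow_subset {P : Type*} [Preorder P]
    (hdcpo : IsDcpo P) (hqc : IsQuasicontinuousDomain P) {D : Set P} {s : P} (hD : D.Nonempty)
    (hdir : DirectedOn (· ≤ ·) D) (hs : IsLUB D s) {V : Set P} (hV : IsUpperSet V)
    (hmeet : ∀ (E : Set P) (t : P), E.Nonempty → DirectedOn (· ≤ ·) E → IsLUB E t →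
      s ≤ t → (E ∩ V).Nonempty) :
    ∃ d ∈ D, ∃ F : Set P, F.Nonempty ∧ F.Finite ∧ WayBelowSet F {d} ∧ F ⊆ V := by
  obtain ⟨F, ⟨hF, hfin, d, hd, hFd⟩, hFV⟩ := hdcpo.exists_subset_of_filtered
    (𝒢 := {F : Set P | F.Nonempty ∧ F.Finite ∧ ∃ d ∈ D, WayBelowSet F {d}})
    (by
      obtain ⟨d, hd⟩ := hD
      obtain ⟨_, F, hF, hfin, hFd, -⟩ := (hqc d).1.1
      exact ⟨F, hF, hfin, d, hd, hFd⟩)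
    (fun F hF => hF.2.1)
    (by
      rintro A ⟨hA, hAfin, a, ha, hAa⟩ B ⟨hB, hBfin, b, hb, hBb⟩
      obtain ⟨d, hd, had, hbd⟩ := hdir a ha b hb
      obtain ⟨_, ⟨C, hC, hCfin, hCd, rfl⟩, hCA, hCB⟩ := (hqc d).1.2
        _ ⟨A, hA, hAfin, hAa.mono_right had, rfl⟩ _ ⟨B, hB, hBfin, hBb.mono_right hbd, rfl⟩
      exact ⟨C, ⟨hC, hCfin, d, hd, hCd⟩, (subset_upSet C).trans (subset_inter hCA hCB)⟩)
    hV fun E t hE hEdir ht hmem => hmeet E t hE hEdir ht (hs.2 fun d hd => by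
      change t ∈ Ici d
      rw [(hqc d).2]
      rintro _ ⟨F, hF, hfin, hFd, rfl⟩
      exact hmem F ⟨hF, hfin, d, hd, hFd⟩)
  exact ⟨d, hd, F, hF, hfin, hFd, hFV⟩

theorem IsQuasicontinuousDomain.scottOpen_setOf_wayBelow {P : Type*} [Preorder P]
    (hdcpo : IsDcpo P) (hqc : IsQuasicontinuousDomain P) (F : Set P) :
    ScottOpen {y | WayBelowSet F {y}} := by
  refine ⟨fun x y hxy hx => hx.mono_right hxy, fun D s hD hdir hs hFs => ?_⟩
  obtain ⟨d, hd, G, -, -, hGd, hGF⟩ := hqc.exists_wayBelow_subset hdcpo hD hdir hs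
    (isUpperSet_upSet F) fun E t hE hEdir ht hst => hFs E t hE hEdir ht ⟨s, rfl, hst⟩
  exact ⟨d, hd, fun E t hE hEdir ht hdt => (hGd E t hE hEdir ht hdt).mono
    (inter_subset_inter_right _ (upSet_subset (isUpperSet_upSet F) hGF))⟩

theorem IsQuasicontinuousDomain.exists_finite_mem_scottInt {P : Type*} [Preorder P]
    (hdcpo : IsDcpo P) (hqc : IsQuasicontinuousDomain P) {U : Set P} (hU : ScottOpen U) {x : P}
    (hx : x ∈ U) :
    ∃ F : Set P, F.Nonempty ∧ F.Finite ∧ x ∈ scottInt P (upSet F) ∧ upSet F ⊆ U := by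
  obtain ⟨_, rfl, F, hF, hfin, hFx, hFU⟩ := hqc.exists_wayBelow_subset hdcpo
    (singleton_nonempty x) (fun a ha b hb => ⟨x, rfl, le_of_eq_of_le ha le_rfl,
      le_of_eq_of_le hb le_rfl⟩) isLUB_singleton hU.1
    fun E t hE hEdir ht hst => hU.2 E t hE hEdir ht (hU.1 hst hx)
  refine ⟨F, hF, hfin, ?_, upSet_subset hU.1 hFU⟩
  let := scottT P
  exact mem_interior.2 ⟨{y | WayBelowSet F {y}}, fun y hy => WayBelowSet.mem_upSet hy,
    hqc.scottOpen_setOf_wayBelow hdcpo F, hFx⟩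

theorem scottOpen_compl_Iic {P : Type*} [Preorder P] (y : P) : ScottOpen (Iic y)ᶜ := by
  refine ⟨(isLowerSet_Iic y).compl, fun D s _ _ hs hsy => ?_⟩
  by_contra h
  exact hsy (hs.2 fun d hd => by_contra fun hdy => h ⟨d, hd, hdy⟩)

theorem isQuasialgebraicDomain_of_exists {P : Type*} [Preorder P]
    (h : ∀ U : Set P, ScottOpen U → ∀ x ∈ U, ∃ G : Set P, G.Nonempty ∧ G.Finite ∧
      ScottOpen (upSet G) ∧ x ∈ upSet G ∧ upSet G ⊆ U) :
    IsQuasialgebraicDomain P := by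
  have h' : ∀ U : Set P, ScottOpen U → ∀ x ∈ U, ∃ S ∈ finCompactFamily x, S ⊆ U := by
    intro U hU x hx
    obtain ⟨G, hG, hfin, hopen, hxG, hGU⟩ := h U hU x hx
    exact ⟨_, ⟨G, hG, hfin, hxG, wayBelowSet_self_iff.2 hopen, rfl⟩, hGU⟩
  refine fun x => ⟨⟨?_, ?_⟩, Subset.antisymm ?_ fun y hy => ?_⟩
  · obtain ⟨S, hS, -⟩ := h' univ (scottT P).isOpen_univ x (mem_univ x)
    exact ⟨S, hS⟩
  · rintro _ ⟨A, -, -, hxA, hA, rfl⟩ _ ⟨B, -, -, hxB, hB, rfl⟩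
    obtain ⟨S, hS, hSAB⟩ := h' _ ((scottT P).isOpen_inter _ _ (wayBelowSet_self_iff.1 hA)
      (wayBelowSet_self_iff.1 hB)) x ⟨hxA, hxB⟩
    exact ⟨S, hS, subset_inter_iff.1 hSAB⟩
  · rintro y hxy _ ⟨A, -, -, hxA, -, rfl⟩
    exact isUpperSet_upSet A hxy hxA
  · by_contra hxy
    obtain ⟨S, hS, hSy⟩ := h' _ (scottOpen_compl_Iic y) x hxy
    exact hSy (hy S hS) le_rfl

/-- In a quasicontinuous domain that is not quasialgebraic there are a Scott open
`U`, a point `x ∈ U` and a nonempty finite `F` with `x ∈ int_σ(↑F) ⊆ ↑F ⊆ U` such that neither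
`↑x` nor `↑F` is Scott open and no Scott open finitely generated upper set fits between
`x` and `U`. -/
theorem exists_witness_of_not_quasialgebraic
    (P : Type*) [PartialOrder P] (hdcpo : IsDcpo P)
    (hqc : IsQuasicontinuousDomain P) (hnqa : ¬ IsQuasialgebraicDomain P) :
    ∃ U : Set P, ScottOpen U ∧ ∃ x ∈ U, ∃ F : Set P, F.Nonempty ∧ F.Finite ∧
      x ∈ scottInt P (upSet F) ∧ scottInt P (upSet F) ⊆ upSet F ∧ upSet F ⊆ U ∧
      ¬ ScottOpen (Set.Ici x) ∧ ¬ ScottOpen (upSet F) ∧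
      ¬ ∃ G : Set P, G.Nonempty ∧ G.Finite ∧ ScottOpen (upSet G) ∧
          x ∈ upSet G ∧ upSet G ⊆ U := by
  by_contra hcon
  refine hnqa (isQuasialgebraicDomain_of_exists fun U hU x hx => ?_)
  by_contra hG
  obtain ⟨F, hF, hfin, hxF, hFU⟩ := hqc.exists_finite_mem_scottInt hdcpo hU hx
  have hsub : scottInt P (upSet F) ⊆ upSet F := @interior_subset P (scottT P) _
  refine hcon ⟨U, hU, x, hx, F, hF, hfin, hxF, hsub, hFU, fun hopen => hG ?_,
    fun hopen => hG ⟨F, hF, hfin, hopen, hsub hxF, hFU⟩, hG⟩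
  rw [← upSet_singleton] at hopen
  exact ⟨{x}, singleton_nonempty x, finite_singleton x, hopen, subset_upSet _ rfl,
    upSet_subset hU.1 (singleton_subset_iff.2 hx)⟩
end

section
/- For a dcpo P, the following are equivalent: (1) P is a quasialgebraic domain; (2) for every x ∈ P and every Scott open set U with x ∈ U, there exists a nonempty finite subset F ⊆ P such that x ∈ int_{σ(P)}(↑F) = ↑F ⊆ U; (3) the Scott topology σ(P) has a basis consisting of sets of the form ↑F with F nonempty finite. -/
open Set

theorem IsChain.exists_mem_disjoint_of_finite {α : Type*} {c : Set (Set α)}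
    (hc : IsChain (· ⊆ ·) c) (hne : c.Nonempty) {F : Set α} (hF : F.Finite)
    (h : ∀ a ∈ F, ∃ C ∈ c, a ∉ C) : ∃ C ∈ c, ∀ a ∈ F, a ∉ C := by
  induction F, hF using Set.Finite.induction_on with
  | empty => exact hne.imp fun C hC => ⟨hC, by simp⟩
  | @insert a F _ _ ih =>
    obtain ⟨C, hC, hCF⟩ := ih fun b hb => h b (mem_insert_of_mem _ hb)
    obtain ⟨C', hC', haC'⟩ := h a (mem_insert _ _)
    rcases hc.total hC hC' with hle | hle
    · refine ⟨C, hC, ?_⟩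
      rintro b (rfl | hb)
      · exact fun hbC => haC' (hle hbC)
      · exact hCF b hb
    · refine ⟨C', hC', ?_⟩
      rintro b (rfl | hb)
      · exact haC'
      · exact fun hbC => hCF b hb (hle hbC)

/-- A form of Rudin's lemma: if a lower set `L` meets every member of a filtered family of
finitely generated upper sets, then some directed subset of `L` meets every member too. -/
theorem exists_directedOn_subset_of_filtered {P : Type*} [Preorder P] {𝒜 : Set (Set P)}
    (h𝒜 : Filtered 𝒜) (hfin : ∀ S ∈ 𝒜, ∃ F : Set P, F.Finite ∧ S = upSet F)
    {L : Set P} (hL : IsLowerSet L) (hmeet : ∀ S ∈ 𝒜, (L ∩ S).Nonempty) :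
    ∃ D ⊆ L, D.Nonempty ∧ DirectedOn (· ≤ ·) D ∧ ∀ S ∈ 𝒜, (D ∩ S).Nonempty := by
  obtain ⟨C, hCL, hC⟩ := zorn_superset_nonempty
    {C : Set P | IsLowerSet C ∧ ∀ S ∈ 𝒜, (C ∩ S).Nonempty} (by
      intro c hcS hc hne
      refine ⟨⋂₀ c, ⟨isLowerSet_sInter fun C hC => (hcS hC).1, fun S hS => ?_⟩,
        fun C hC => sInter_subset_of_mem hC⟩
      obtain ⟨F, hF, rfl⟩ := hfin S hS
      by_contra hempty
      obtain ⟨C, hC, hCF⟩ := hc.exists_mem_disjoint_of_finite hne hF fun a ha => by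
        by_contra! hall
        exact hempty ⟨a, hall, a, ha, le_rfl⟩
      obtain ⟨y, hyC, a, ha, hay⟩ := (hcS hC).2 _ hS
      exact hCF a ha ((hcS hC).1 hay hyC)) L ⟨hL, hmeet⟩
  obtain ⟨hClow, hCmeet⟩ := hC.prop
  have cut : ∀ a ∈ C, ∃ S ∈ 𝒜, ∀ y ∈ C, y ∈ S → a ≤ y := by
    intro a ha
    by_contra! hall
    have hmem : IsLowerSet (C \ Ici a) ∧ ∀ S ∈ 𝒜, ((C \ Ici a) ∩ S).Nonempty := by
      refine ⟨fun y z hzy hy => ⟨hClow hzy hy.1, fun haz => hy.2 (le_trans haz hzy)⟩, ?_⟩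
      intro S hS
      obtain ⟨y, hyC, hyS, hay⟩ := hall S hS
      exact ⟨y, ⟨hyC, hay⟩, hyS⟩
    exact (hC.le_of_le hmem sdiff_subset ha).2 le_rfl
  refine ⟨C, hCL, ?_, ?_, hCmeet⟩
  · obtain ⟨S, hS⟩ := h𝒜.1
    exact (hCmeet S hS).left
  · intro a ha b hb
    obtain ⟨S, hS, haS⟩ := cut a ha
    obtain ⟨T, hT, hbT⟩ := cut b hb
    obtain ⟨R, hR, hRS, hRT⟩ := h𝒜.2 S hS T hT
    obtain ⟨y, hyC, hyR⟩ := hCmeet R hR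
    exact ⟨y, hyC, haS y hyC (hRS hyR), hbT y hyC (hRT hyR)⟩

theorem scottOpen_upSet_iff {P : Type*} [Preorder P] {F : Set P} :
    ScottOpen (upSet F) ↔ WayBelowSet F F :=
  ⟨fun h => h.2, fun h => ⟨isUpperSet_upSet F, h⟩⟩

theorem scottInt_eq_iff {P : Type*} [Preorder P] {A : Set P} :
    scottInt P A = A ↔ ScottOpen A :=
  @interior_eq_iff_isOpen P (scottT P) A

/-- In a dcpo, a Scott open set containing the intersection of a filtered family of finitely
generated upper sets contains a member of the family. -/
theorem ScottOpen.exists_mem_subset_of_sInter_subset {P : Type*} [Preorder P]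
    (hdcpo : IsDcpo P) {𝒜 : Set (Set P)} (h𝒜 : Filtered 𝒜)
    (hfin : ∀ S ∈ 𝒜, ∃ F : Set P, F.Finite ∧ S = upSet F) {U : Set P} (hU : ScottOpen U)
    (hsub : ⋂₀ 𝒜 ⊆ U) : ∃ S ∈ 𝒜, S ⊆ U := by
  by_contra! hnot
  obtain ⟨D, hDU, hne, hdir, hmeet⟩ := exists_directedOn_subset_of_filtered h𝒜 hfin hU.1.compl
    fun S hS => by
      obtain ⟨y, hyS, hyU⟩ := not_subset.1 (hnot S hS)
      exact ⟨y, hyU, hyS⟩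
  obtain ⟨s, hs⟩ := hdcpo D hne hdir
  have hsU : s ∈ U := hsub fun S hS => by
    obtain ⟨d, hdD, hdS⟩ := hmeet S hS
    obtain ⟨F, -, rfl⟩ := hfin S hS
    exact isUpperSet_upSet F (hs.1 hdD) hdS
  obtain ⟨d, hdD, hdU⟩ := hU.2 D s hne hdir hs hsU
  exact hDU hdD hdU

theorem isQuasialgebraicDomain_iff_exists_scottOpen_upSet {P : Type*} [Preorder P]
    (hdcpo : IsDcpo P) :
    IsQuasialgebraicDomain P ↔
      ∀ U : Set P, ScottOpen U → ∀ x ∈ U,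
        ∃ F : Set P, F.Nonempty ∧ F.Finite ∧ ScottOpen (upSet F) ∧
          x ∈ upSet F ∧ upSet F ⊆ U := by
  constructor
  · intro h U hU x hx
    obtain ⟨hfilt, hinter⟩ := h x
    obtain ⟨S, ⟨F, hne, hF, hxF, hFF, rfl⟩, hSU⟩ := hU.exists_mem_subset_of_sInter_subset hdcpo
      hfilt (fun S ⟨F, _, hF, _, _, hS⟩ => ⟨F, hF, hS⟩) (hinter ▸ fun y hy => hU.1 hy hx)
    exact ⟨F, hne, hF, scottOpen_upSet_iff.2 hFF, hxF, hSU⟩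
  · intro h x
    have key : ∀ U : Set P, ScottOpen U → x ∈ U → ∃ R ∈ finCompactFamily x, R ⊆ U := by
      intro U hU hx
      obtain ⟨F, hne, hF, hopen, hxF, hFU⟩ := h U hU x hx
      exact ⟨_, ⟨F, hne, hF, hxF, scottOpen_upSet_iff.1 hopen, rfl⟩, hFU⟩
    refine ⟨⟨?_, ?_⟩, Subset.antisymm ?_ ?_⟩
    · obtain ⟨R, hR, -⟩ := key univ (scottT P).isOpen_univ (mem_univ x)
      exact ⟨R, hR⟩
    · rintro _ ⟨F, -, -, hxF, hFF, rfl⟩ _ ⟨G, -, -, hxG, hGG, rfl⟩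
      obtain ⟨R, hR, hRsub⟩ := key (upSet F ∩ upSet G)
        ((scottT P).isOpen_inter _ _ (scottOpen_upSet_iff.2 hFF) (scottOpen_upSet_iff.2 hGG))
        ⟨hxF, hxG⟩
      exact ⟨R, hR, subset_inter_iff.1 hRsub⟩
    · rintro y hy _ ⟨F, -, -, hxF, -, rfl⟩
      exact isUpperSet_upSet F hy hxF
    · intro y hy
      by_contra hxy
      obtain ⟨R, hR, hRsub⟩ := key (Iic y)ᶜ (scottOpen_compl_Iic y) hxy
      exact hRsub (hy R hR) le_rfl

/-- For a dcpo `P` the following are equivalent: (1) `P` is quasialgebraic;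
(2) for every `x` and Scott open `U ∋ x` there is a nonempty finite `F` with
`x ∈ int_σ(↑F) = ↑F ⊆ U`; (3) the Scott open sets of the form `↑F` (`F` nonempty finite)
form a basis of the Scott topology. -/
theorem quasialgebraic_characterizations
    (P : Type*) [PartialOrder P] (hdcpo : IsDcpo P) :
    (IsQuasialgebraicDomain P ↔
      ∀ x : P, ∀ U : Set P, ScottOpen U → x ∈ U →
        ∃ F : Set P, F.Nonempty ∧ F.Finite ∧
          x ∈ scottInt P (upSet F) ∧ scottInt P (upSet F) = upSet F ∧ upSet F ⊆ U) ∧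
    (IsQuasialgebraicDomain P ↔
      ∀ U : Set P, ScottOpen U → ∀ x ∈ U,
        ∃ F : Set P, F.Nonempty ∧ F.Finite ∧ ScottOpen (upSet F) ∧
          x ∈ upSet F ∧ upSet F ⊆ U) := by
  refine ⟨(isQuasialgebraicDomain_iff_exists_scottOpen_upSet hdcpo).trans ⟨?_, ?_⟩,
    isQuasialgebraicDomain_iff_exists_scottOpen_upSet hdcpo⟩
  · intro h x U hU hx
    obtain ⟨F, hne, hF, hopen, hxF, hFU⟩ := h U hU x hx
    have hint := scottInt_eq_iff.2 hopen
    exact ⟨F, hne, hF, hint.symm ▸ hxF, hint, hFU⟩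
  · intro h U hU x hx
    obtain ⟨F, hne, hF, hxF, hint, hFU⟩ := h x U hU hx
    exact ⟨F, hne, hF, scottInt_eq_iff.1 hint, hint ▸ hxF, hFU⟩
end
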